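/- Let b ∈ ℝ^m, A ∈ M_{m,n}(ℝ), c > 0, t > 1, and weighted vectors α, β as above. If for every u ∈ ℤ^m one has ‖u·b‖_ℤ ≤ 2^{m+n−1}((m+n)!)^{−2} · max{ max_{1≤j≤n} t^{β_j} ‖A_{*,j}·u‖_ℤ , max_{1≤i≤m} c^{α_i}|u_i| }, then there exists q ∈ ℤⁿ such that ‖Aq + b‖_{ℤ,α} ≤ c and |q|_β ≤ t. -/

import Mathlib

/-- Distance from a real number to the nearest integer. -/
noncomputable def distZ (x : ℝ) : ℝ := |x - round x|

/-- A uniformly discrete additive subgroup of a finite-dimensional space, given as the range of a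
homomorphism, has a shortest nonzero vector. -/
theorem exists_shortest_vector {G E : Type*} [AddCommGroup G] [NormedAddCommGroup E]
    [ProperSpace E] (ι : G →+ E) {r : ℝ} (hr : 0 < r)
    (hdisc : ∀ g, ι g ≠ 0 → r ≤ ‖ι g‖) (hne : ∃ g, ι g ≠ 0) :
    ∃ g₁, ι g₁ ≠ 0 ∧ ∀ g, ι g ≠ 0 → ‖ι g₁‖ ≤ ‖ι g‖ := by
  obtain ⟨g₀, hg₀⟩ := hne
  have : DiscreteTopology ι.range := by
    refine DiscreteTopology.of_forall_le_dist hr ?_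
    rintro ⟨_, a, rfl⟩ ⟨_, b, rfl⟩ hab
    have hab' : ι (a - b) ≠ 0 := by
      rw [map_sub, sub_ne_zero]
      exact fun h => hab (Subtype.ext h)
    simpa [Subtype.dist_eq, dist_eq_norm] using hdisc _ hab'
  have hfin : (Metric.closedBall (0 : E) ‖ι g₀‖ ∩ (ι.range : Set E)).Finite :=
    Metric.finite_isBounded_inter_isClosed ⟨this⟩ Metric.isBounded_closedBall
      (AddSubgroup.isClosed_of_discrete (H := ι.range))
  obtain ⟨w, ⟨⟨hw, g₁, rfl⟩, hw0⟩, hmin⟩ :=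
    (hfin.subset (Set.sdiff_subset (t := {0}))).exists_minimalFor (fun w => ‖w‖) _
      ⟨ι g₀, ⟨by simp, g₀, rfl⟩, hg₀⟩
  refine ⟨g₁, hw0, fun g hg => ?_⟩
  by_contra! hlt
  have hw' : ‖ι g₁‖ ≤ ‖ι g₀‖ := by simpa using hw
  exact absurd (hmin ⟨⟨by simpa using hlt.le.trans hw', g, rfl⟩, hg⟩ hlt.le) (not_le.mpr hlt)

/-- A character of a discrete subgroup of a Euclidean space whose values are small relative to
the norm is induced by a short vector. -/
theorem exists_short_vector_of_character {G : Type*} [AddCommGroup G] (d : ℕ) :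
    ∀ {E : Type*} [NormedAddCommGroup E] [InnerProductSpace ℝ E] [FiniteDimensional ℝ E]
      (_ : Module.finrank ℝ E = d) (ι : G →+ E) (φ : G →+ UnitAddCircle) (ε r : ℝ) (_ : 0 ≤ ε)
      (_ : 0 < r) (_ : ∀ g, ι g ≠ 0 → r ≤ ‖ι g‖) (_ : ∀ g, ‖φ g‖ ≤ ε * ‖ι g‖),
      ∃ y : E, ‖y‖ ^ 2 ≤ ε ^ 2 * ((3 ^ d - 1) / 2) ∧
        ∀ g, φ g = ((inner ℝ y (ι g) : ℝ) : UnitAddCircle) := by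
  have trivial_case : ∀ {E : Type _} [NormedAddCommGroup E] [InnerProductSpace ℝ E] (d : ℕ)
      (ι : G →+ E) (φ : G →+ UnitAddCircle) (ε : ℝ) (_ : ∀ g, ‖φ g‖ ≤ ε * ‖ι g‖)
      (_ : ∀ g, ι g = 0),
      ∃ y : E, ‖y‖ ^ 2 ≤ ε ^ 2 * ((3 ^ d - 1) / 2) ∧
        ∀ g, φ g = ((inner ℝ y (ι g) : ℝ) : UnitAddCircle) := by
    intro E _ _ d ι φ ε hφ h0
    refine ⟨0, ?_, fun g => ?_⟩
    · have : (1 : ℝ) ≤ 3 ^ d := one_le_pow₀ (by norm_num)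
      have : 0 ≤ ε ^ 2 * (((3 : ℝ) ^ d - 1) / 2) := by
        apply mul_nonneg (sq_nonneg _); linarith
      simpa using this
    · have : ‖φ g‖ ≤ 0 := by simpa [h0 g] using hφ g
      simpa using norm_le_zero_iff.mp this
  induction d with
  | zero =>
    intro E _ _ _ hd ι φ ε r _ _ _ hφ
    have := Module.finrank_zero_iff.mp hd
    exact trivial_case 0 ι φ ε hφ fun g => Subsingleton.elim _ _
  | succ d ih =>
    intro E _ _ _ hd ι φ ε r hε hr hdisc hφ
    by_cases hne : ∃ g, ι g ≠ 0
    swap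
    · push Not at hne
      exact trivial_case (d + 1) ι φ ε hφ hne
    obtain ⟨g₁, hg₁, hmin⟩ := exists_shortest_vector ι hr hdisc hne
    set w := ι g₁ with hw
    set μ := ‖w‖ with hμ
    have hμpos : 0 < μ := norm_pos_iff.mpr hg₁
    obtain ⟨ρ, hρφ, hρ⟩ : ∃ ρ : ℝ, (ρ : UnitAddCircle) = φ g₁ ∧ |ρ| = ‖φ g₁‖ := by
      obtain ⟨x, hx⟩ := QuotientAddGroup.mk_surjective (φ g₁)
      refine ⟨x - round x, ?_, ?_⟩
      · rw [← hx]
        have : ((round x : ℝ) : UnitAddCircle) = 0 := by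
          rw [AddCircle.coe_eq_zero_iff]; exact ⟨round x, by simp⟩
        rw [AddCircle.coe_sub, this, sub_zero]
      · rw [← hx]; exact (UnitAddCircle.norm_eq (x := x)).symm
    have hρle : |ρ| ≤ ε * μ := hρ ▸ hφ g₁
    set δ : E := (ρ / μ ^ 2) • w with hδ
    have hδnorm : ‖δ‖ ^ 2 ≤ ε ^ 2 := by
      rw [hδ, norm_smul, ← hμ, Real.norm_eq_abs, abs_div, abs_of_pos (pow_pos hμpos 2)]
      have : |ρ| / μ ^ 2 * μ = |ρ| / μ := by field_simp
      rw [this]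
      exact pow_le_pow_left₀ (by positivity) ((div_le_iff₀ hμpos).mpr hρle) 2
    let ψ : G →+ UnitAddCircle := φ -
      (QuotientAddGroup.mk' (AddSubgroup.zmultiples (1 : ℝ))).comp
        ((innerSL ℝ δ).toLinearMap.toAddMonoidHom.comp ι)
    have hψ : ∀ g, ψ g = φ g - ((inner ℝ δ (ι g) : ℝ) : UnitAddCircle) := fun g => rfl
    have hδw : inner ℝ δ w = ρ := by
      rw [hδ, real_inner_smul_left, real_inner_self_eq_norm_sq, ← hμ]
      field_simp
    have hψ₁ : ψ g₁ = 0 := by rw [hψ, ← hw, hδw, hρφ, sub_self]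
    let F : Submodule ℝ E := (ℝ ∙ w)ᗮ
    let π : G →+ F := F.orthogonalProjectionOnto.toLinearMap.toAddMonoidHom.comp ι
    have hπ : ∀ g, π g = F.orthogonalProjectionOnto (ι g) := fun g => rfl
    have hwF : ∀ y : F, inner ℝ (y : E) w = 0 := fun y =>
      Submodule.mem_orthogonal_singleton_iff_inner_left.mp y.2
    have hπ₁ : π g₁ = 0 := by
      rw [hπ, ← hw]
      exact Submodule.orthogonalProjectionOnto_apply_of_mem_orthogonal
        (Submodule.le_orthogonal_orthogonal _ (Submodule.mem_span_singleton_self w))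
    have hdecomp : ∀ g, ∃ s : ℝ, ι g = s • w + (π g : E) := by
      intro g
      have h1 : ι g - F.orthogonalProjectionOnto (ι g) ∈ Fᗮ :=
        Submodule.sub_starProjection_mem_orthogonal _
      rw [Submodule.orthogonal_orthogonal] at h1
      obtain ⟨s, hs⟩ := Submodule.mem_span_singleton.mp h1
      exact ⟨s, by rw [hs, hπ]; abel⟩
    have key : ∀ g, ∃ (h : G) (s : ℝ), π h = π g ∧ ψ h = ψ g ∧
        ι h = s • w + (π g : E) ∧ |s| ≤ 1 / 2 := by
      intro g
      obtain ⟨s, hs⟩ := hdecomp g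
      refine ⟨g - round s • g₁, s - round s, ?_, ?_, ?_, abs_sub_round s⟩
      · rw [map_sub, map_zsmul, hπ₁, smul_zero, sub_zero]
      · rw [map_sub, map_zsmul, hψ₁, smul_zero, sub_zero]
      · rw [map_sub, map_zsmul, hs, ← hw, sub_smul, Int.cast_smul_eq_zsmul]; abel
    have hpyth : ∀ (s : ℝ) (p : F), ‖s • w + (p : E)‖ ^ 2 = (|s| * μ) ^ 2 + ‖p‖ ^ 2 := by
      intro s p
      have := norm_add_sq_eq_norm_sq_add_norm_sq_real (x := s • w) (y := (p : E))
        (by rw [real_inner_smul_left, real_inner_comm, hwF, mul_zero])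
      rw [norm_smul, Real.norm_eq_abs] at this
      simpa only [sq, Submodule.coe_norm] using this
    have hπdisc : ∀ g, π g ≠ 0 → μ / 2 ≤ ‖π g‖ := by
      intro g hg
      obtain ⟨h, s, h1, -, h3, h4⟩ := key g
      have h0 : ι h ≠ 0 := fun h0 => hg (by rw [← h1, hπ, h0, map_zero])
      have h5 := hmin h h0
      have h6 := hpyth s (π g)
      rw [← h3] at h6
      have h7 : |s| * μ ≤ μ / 2 := by nlinarith
      have h8 : 0 ≤ |s| * μ := by positivity
      refine le_of_sq_le_sq ?_ (norm_nonneg _)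
      nlinarith
    have hψle : ∀ g, ‖ψ g‖ ≤ (√3 * ε) * ‖π g‖ := by
      intro g
      obtain ⟨h, s, h1, h2, h3, h4⟩ := key g
      rw [← h2, hψ]
      by_cases h0 : ι h = 0
      · have : φ h = 0 := norm_le_zero_iff.mp (by simpa [h0] using hφ h)
        rw [this, h0, inner_zero_right, AddCircle.coe_zero, sub_zero, norm_zero]
        positivity
      have h5 := hmin h h0
      have h6 := hpyth s (π g)
      rw [← h3] at h6
      have h7 : |s| * μ ≤ μ / 2 := by nlinarith
      have h8 : 0 ≤ |s| * μ := by positivity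
      have h9 : inner ℝ δ (ι h) = s * ρ := by
        rw [h3, inner_add_right, real_inner_smul_right, hδw, hδ, real_inner_smul_left,
          real_inner_comm, hwF, mul_zero, add_zero]
      have h10 : ‖((inner ℝ δ (ι h) : ℝ) : UnitAddCircle)‖ ≤ ε * (|s| * μ) := by
        calc _ ≤ |inner ℝ δ (ι h)| := by
              rw [UnitAddCircle.norm_eq]
              simpa using round_le (inner ℝ δ (ι h)) 0
          _ = |s| * |ρ| := by rw [h9, abs_mul]
          _ ≤ |s| * (ε * μ) := by gcongr
          _ = _ := by ring
      have h11 : ‖ι h‖ + |s| * μ ≤ √3 * ‖π g‖ := by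
        refine le_of_sq_le_sq ?_ (by positivity)
        rw [mul_pow, Real.sq_sqrt (by norm_num)]
        nlinarith
      calc _ ≤ ‖φ h‖ + ‖((inner ℝ δ (ι h) : ℝ) : UnitAddCircle)‖ := norm_sub_le _ _
        _ ≤ ε * ‖ι h‖ + ε * (|s| * μ) := add_le_add (hφ h) h10
        _ = ε * (‖ι h‖ + |s| * μ) := by ring
        _ ≤ ε * (√3 * ‖π g‖) := by gcongr
        _ = _ := by ring
    have hFd : Module.finrank ℝ F = d := by
      have : Fact (Module.finrank ℝ E = d + 1) := ⟨hd⟩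
      exact Submodule.finrank_orthogonal_span_singleton hg₁
    obtain ⟨y, hy, hyψ⟩ := ih hFd π ψ (√3 * ε) (μ / 2) (by positivity) (by positivity) hπdisc hψle
    refine ⟨δ + y, ?_, fun g => ?_⟩
    · have h1 := hpyth (ρ / μ ^ 2) y
      have h2 := hpyth (ρ / μ ^ 2) 0
      rw [← hδ] at h1 h2
      rw [mul_pow, Real.sq_sqrt (by norm_num)] at hy
      simp only [Submodule.coe_zero, add_zero, norm_zero] at h2
      calc _ = ‖δ‖ ^ 2 + ‖y‖ ^ 2 := by rw [h1, h2]; ring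
        _ ≤ ε ^ 2 + 3 * ε ^ 2 * ((3 ^ d - 1) / 2) := add_le_add hδnorm hy
        _ = _ := by ring
    · have h1 : inner ℝ (y : E) (ι g) = inner ℝ y (π g) := by
        obtain ⟨s, hs⟩ := hdecomp g
        rw [hs, inner_add_right, real_inner_smul_right, hwF, mul_zero, zero_add,
          Submodule.coe_inner]
      rw [inner_add_left, AddCircle.coe_add, h1, ← hyψ, hψ]
      abel

/-- The transference constant is small enough for the bound in
`exists_short_vector_of_character`. -/
theorem four_pow_mul_three_pow_sub_one_le (k : ℕ) :
    (4 : ℝ) ^ (k + 1) * (3 ^ (k + 2) - 1) ≤ 2 * ((k + 2).factorial : ℝ) ^ 4 := by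
  induction k with
  | zero => norm_num [Nat.factorial]
  | succ k ih =>
    have h3 : (1 : ℝ) ≤ 3 ^ k := one_le_pow₀ (by norm_num)
    have hk : (16 : ℝ) ≤ ((k : ℝ) + 3) ^ 4 := by
      have : (2 : ℝ) ^ 4 ≤ ((k : ℝ) + 3) ^ 4 :=
        pow_le_pow_left₀ (by norm_num) (by linarith [k.cast_nonneg (α := ℝ)]) 4
      linarith
    have hfac : (((k + 1 + 2).factorial : ℕ) : ℝ) = ((k : ℝ) + 3) * ((k + 2).factorial : ℝ) := by
      rw [show k + 1 + 2 = (k + 2) + 1 from rfl, Nat.factorial_succ]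
      push_cast; ring
    rw [hfac, mul_pow]
    calc (4 : ℝ) ^ (k + 1 + 1) * (3 ^ (k + 1 + 2) - 1)
        = 4 ^ (k + 1) * (4 * (27 * 3 ^ k - 1)) := by ring
      _ ≤ 4 ^ (k + 1) * (16 * (9 * 3 ^ k - 1)) := by gcongr 4 ^ (k + 1) * ?_; linarith
      _ = 16 * (4 ^ (k + 1) * (3 ^ (k + 2) - 1)) := by ring
      _ ≤ 16 * (2 * ((k + 2).factorial : ℝ) ^ 4) := by gcongr
      _ ≤ ((k : ℝ) + 3) ^ 4 * (2 * ((k + 2).factorial : ℝ) ^ 4) := by gcongr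
      _ = _ := by ring

/-- `distZ` is the distance to the nearest integer. -/
theorem distZ_le_abs_sub_intCast (x : ℝ) (k : ℤ) : distZ x ≤ |x - k| := round_le x k

/-- The homomorphism parametrizing the lattice of weighted linear forms dual to the system
`A q + b`. -/
noncomputable def weightedForms {m n : ℕ} (A : Matrix (Fin m) (Fin n) ℝ) (C : Fin m → ℝ)
    (T : Fin n → ℝ) :
    (Fin m → ℤ) × (Fin n → ℤ) →+ EuclideanSpace ℝ (Fin m ⊕ Fin n) where
  toFun g := WithLp.toLp 2 (Sum.elim (fun i => C i * (g.1 i : ℝ))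
    (fun j => T j * ((∑ i, A i j * (g.1 i : ℝ)) + g.2 j)))
  map_zero' := by
    ext (i | j) <;> simp
  map_add' g h := by
    ext (i | j)
    · simp [mul_add]
    · simp only [PiLp.add_apply, Sum.elim_inr, Prod.fst_add, Prod.snd_add, Pi.add_apply,
        Int.cast_add, mul_add, Finset.sum_add_distrib]
      ring

/-- A vector pairing with the weighted forms as the character `u ↦ u · b` yields an integral
approximate solution of `A q + b`. -/
theorem exists_int_solution_of_inner_weightedForms {m n : ℕ} (A : Matrix (Fin m) (Fin n) ℝ)
    (b C : Fin m → ℝ) (T : Fin n → ℝ) (hC : ∀ i, 0 < C i) (hT : ∀ j, 0 < T j)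
    (y : EuclideanSpace ℝ (Fin m ⊕ Fin n)) (hy : ‖y‖ ≤ 1)
    (h : ∀ g : (Fin m → ℤ) × (Fin n → ℤ), ((∑ i, (g.1 i : ℝ) * b i : ℝ) : UnitAddCircle) =
      ((inner ℝ y (weightedForms A C T g) : ℝ) : UnitAddCircle)) :
    ∃ q : Fin n → ℤ, (∀ i, distZ ((∑ j, A i j * (q j : ℝ)) + b i) ≤ C i) ∧
      ∀ j, |(q j : ℝ)| ≤ T j := by
  have hcoord : ∀ s, |y s| ≤ 1 := fun s => (PiLp.norm_apply_le y s).trans hy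
  have hint : ∀ g : (Fin m → ℤ) × (Fin n → ℤ), ∃ k : ℤ,
      (∑ i, (g.1 i : ℝ) * b i) - inner ℝ y (weightedForms A C T g) = k := by
    intro g
    have := sub_eq_zero.mpr (h g)
    rw [← AddCircle.coe_sub, AddCircle.coe_eq_zero_iff] at this
    obtain ⟨k, hk⟩ := this
    exact ⟨k, by rw [← hk]; simp⟩
  have hinner : ∀ g, inner ℝ y (weightedForms A C T g) =
      (∑ i, C i * (g.1 i : ℝ) * y (Sum.inl i)) +
        ∑ j, T j * ((∑ i, A i j * (g.1 i : ℝ)) + g.2 j) * y (Sum.inr j) := by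
    intro g
    simp [PiLp.inner_apply, weightedForms]
  have hq : ∀ j, ∃ k : ℤ, -(T j * y (Sum.inr j)) = k := by
    intro j
    obtain ⟨k, hk⟩ := hint (0, Pi.single j 1)
    refine ⟨k, ?_⟩
    rw [← hk, hinner]
    simp [Pi.single_apply]
  choose q hq using hq
  refine ⟨q, fun i => ?_, fun j => ?_⟩
  · obtain ⟨k, hk⟩ := hint (Pi.single i 1, 0)
    rw [hinner] at hk
    have hsum : ∑ j, A i j * (q j : ℝ) = -∑ j, T j * A i j * y (Sum.inr j) := by
      rw [← Finset.sum_neg_distrib]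
      refine Finset.sum_congr rfl fun j _ => ?_
      rw [← hq]; ring
    refine (distZ_le_abs_sub_intCast _ k).trans ?_
    have : (∑ j, A i j * (q j : ℝ)) + b i - k = C i * y (Sum.inl i) := by
      rw [← hk, hsum]
      simp [Pi.single_apply]
      ring
    rw [this, abs_mul, abs_of_pos (hC i)]
    exact mul_le_of_le_one_right (hC i).le (hcoord _)
  · rw [← hq, abs_neg, abs_mul, abs_of_pos (hT j)]
    exact mul_le_of_le_one_right (hT j).le (hcoord _)

/-- Nonzero values of the weighted forms are bounded away from zero. -/
theorem exists_pos_le_norm_weightedForms {m n : ℕ} (A : Matrix (Fin m) (Fin n) ℝ)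
    (C : Fin m → ℝ) (T : Fin n → ℝ) (hC : ∀ i, 0 < C i) (hT : ∀ j, 0 < T j) :
    ∃ r > 0, ∀ g, weightedForms A C T g ≠ 0 → r ≤ ‖weightedForms A C T g‖ := by
  obtain ⟨r, hr, hrle⟩ : ∃ r > 0, ∀ s, r ≤ Sum.elim C T s := by
    have hpos : ∀ s, 0 < Sum.elim C T s := by rintro (i | j) <;> simp [hC, hT]
    rcases isEmpty_or_nonempty (Fin m ⊕ Fin n) with he | he
    · exact ⟨1, one_pos, fun s => he.elim s⟩
    · obtain ⟨s₀, hs₀⟩ := Finite.exists_min (Sum.elim C T)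
      exact ⟨_, hpos s₀, hs₀⟩
  have hone : ∀ k : ℤ, k ≠ 0 → (1 : ℝ) ≤ |(k : ℝ)| := fun k hk => by
    exact_mod_cast Int.one_le_abs hk
  refine ⟨r, hr, fun g hg => ?_⟩
  by_cases hu : g.1 = 0
  · have hv : g.2 ≠ 0 := fun hv => hg (by rw [show g = 0 from Prod.ext hu hv, map_zero])
    obtain ⟨j, hj⟩ := Function.ne_iff.mp hv
    refine le_trans ?_ (PiLp.norm_apply_le _ (Sum.inr j))
    have : weightedForms A C T g (Sum.inr j) = T j * (g.2 j : ℝ) := by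
      simp [weightedForms, hu]
    rw [this, Real.norm_eq_abs, abs_mul, abs_of_pos (hT j)]
    exact (hrle (Sum.inr j)).trans (le_mul_of_one_le_right (hT j).le (hone _ hj))
  · obtain ⟨i, hi⟩ := Function.ne_iff.mp hu
    refine le_trans ?_ (PiLp.norm_apply_le _ (Sum.inl i))
    have : weightedForms A C T g (Sum.inl i) = C i * (g.1 i : ℝ) := rfl
    rw [this, Real.norm_eq_abs, abs_mul, abs_of_pos (hC i)]
    exact (hrle (Sum.inl i)).trans (le_mul_of_one_le_right (hC i).le (hone _ hi))

/-- Weighted transference principle (Cassels, Theorem XVII), part (2): if `‖u·b‖_ℤ` is small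
for every `u ∈ ℤ^m`, then the inhomogeneous system has a solution. -/
theorem transference_part_two (m n : ℕ) (hm : 0 < m) (hn : 0 < n)
    (A : Matrix (Fin m) (Fin n) ℝ) (b : Fin m → ℝ)
    (α : Fin m → ℝ) (hα_pos : ∀ i, 0 < α i) (hα_sum : ∑ i, α i = 1)
    (β : Fin n → ℝ) (hβ_pos : ∀ j, 0 < β j) (hβ_sum : ∑ j, β j = 1)
    (c t : ℝ) (hc : 0 < c) (ht : 1 < t)
    (hsmall : ∀ u : Fin m → ℤ,
      distZ (∑ i, (u i : ℝ) * b i) ≤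
        2 ^ (m + n - 1) / ((Nat.factorial (m + n) : ℝ)) ^ 2 *
          max (⨆ j, t ^ β j * distZ (∑ i, A i j * (u i : ℝ)))
            (⨆ i, c ^ α i * |(u i : ℝ)|)) :
    ∃ q : Fin n → ℤ,
      (⨆ i, distZ ((∑ j, A i j * (q j : ℝ)) + b i) ^ ((1 : ℝ) / α i)) ≤ c ∧
      (⨆ j, |(q j : ℝ)| ^ ((1 : ℝ) / β j)) ≤ t := by
  have : Nonempty (Fin m) := ⟨⟨0, hm⟩⟩
  have : Nonempty (Fin n) := ⟨⟨0, hn⟩⟩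
  have htpos : 0 < t := one_pos.trans ht
  set C : Fin m → ℝ := fun i => c ^ α i with hCdef
  set T : Fin n → ℝ := fun j => t ^ β j with hTdef
  have hC : ∀ i, 0 < C i := fun i => Real.rpow_pos_of_pos hc _
  have hT : ∀ j, 0 < T j := fun j => Real.rpow_pos_of_pos htpos _
  set ε : ℝ := 2 ^ (m + n - 1) / ((Nat.factorial (m + n) : ℝ)) ^ 2 with hεdef
  have hε : 0 ≤ ε := by positivity
  let φ : (Fin m → ℤ) × (Fin n → ℤ) →+ UnitAddCircle :=
    { toFun := fun g => ((∑ i, (g.1 i : ℝ) * b i : ℝ) : UnitAddCircle)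
      map_zero' := by simp
      map_add' := fun g h => by
        rw [← AddCircle.coe_add, ← Finset.sum_add_distrib]
        simp [add_mul] }
  have hφ : ∀ g, ‖φ g‖ ≤ ε * ‖weightedForms A C T g‖ := by
    intro g
    have h1 : ‖φ g‖ = distZ (∑ i, (g.1 i : ℝ) * b i) := UnitAddCircle.norm_eq
    rw [h1]
    refine (hsmall g.1).trans (mul_le_mul_of_nonneg_left (max_le ?_ ?_) hε)
    · refine ciSup_le fun j => le_trans ?_ (PiLp.norm_apply_le _ (Sum.inr j))
      have : weightedForms A C T g (Sum.inr j) =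
        T j * ((∑ i, A i j * (g.1 i : ℝ)) + g.2 j) := rfl
      rw [this, Real.norm_eq_abs, abs_mul, abs_of_pos (hT j)]
      refine mul_le_mul_of_nonneg_left ?_ (hT j).le
      simpa using distZ_le_abs_sub_intCast (∑ i, A i j * (g.1 i : ℝ)) (-g.2 j)
    · refine ciSup_le fun i => le_trans ?_ (PiLp.norm_apply_le _ (Sum.inl i))
      have : weightedForms A C T g (Sum.inl i) = C i * (g.1 i : ℝ) := rfl
      rw [this, Real.norm_eq_abs, abs_mul, abs_of_pos (hC i)]
  obtain ⟨r, hr, hdisc⟩ := exists_pos_le_norm_weightedForms A C T hC hT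
  obtain ⟨y, hy, hyφ⟩ := exists_short_vector_of_character (m + n) (by simp)
    (weightedForms A C T) φ ε r hε hr hdisc hφ
  have hy1 : ‖y‖ ≤ 1 := by
    obtain ⟨k, hk⟩ : ∃ k, m + n = k + 2 := ⟨m + n - 2, by omega⟩
    have hconst : ε ^ 2 * ((3 ^ (m + n) - 1) / 2) ≤ 1 := by
      have h := four_pow_mul_three_pow_sub_one_le k
      have hpow : ((2 : ℝ) ^ (k + 1)) ^ 2 = 4 ^ (k + 1) := by
        rw [← pow_mul, mul_comm, pow_mul]; norm_num
      rw [hεdef, hk, show k + 2 - 1 = k + 1 from rfl, div_pow, hpow, ← pow_mul,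
        div_mul_div_comm, div_le_one (by positivity)]
      norm_num only
      linarith
    exact (sq_le_one_iff₀ (norm_nonneg y)).mp (hy.trans hconst)
  obtain ⟨q, hq1, hq2⟩ := exists_int_solution_of_inner_weightedForms A b C T hC hT y hy1 hyφ
  have hroot : ∀ {x a e : ℝ}, 0 ≤ x → 0 < a → 0 < e → x ≤ a ^ e → x ^ ((1 : ℝ) / e) ≤ a := by
    intro x a e hx ha he hxa
    calc x ^ ((1 : ℝ) / e) ≤ (a ^ e) ^ ((1 : ℝ) / e) :=
          Real.rpow_le_rpow hx hxa (by positivity)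
      _ = a := by rw [← Real.rpow_mul ha.le, mul_one_div_cancel he.ne', Real.rpow_one]
  exact ⟨q, ciSup_le fun i => hroot (abs_nonneg _) hc (hα_pos i) (hq1 i),
    ciSup_le fun j => hroot (abs_nonneg _) htpos (hβ_pos j) (hq2 j)⟩
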